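/- Let T and K be natural numbers with 1 ≤ K ≤ T, and let v, w ∈ ℝ^T be vectors with nonnegative entries. If v has exactly K nonzero entries all equal to a common value α > 0 with K·α² = T (so ∑_s v_s² = T), and w has nonnegative entries with ∑_s w_s² = T but w is not of this form (i.e., the K largest entries of w are not all equal, or some entry outside the K largest is nonzero), then R(v,K) > R(w,K), where R(·,K) denotes the sum of the K largest entries. -/

import Mathlib

/-- The K-spectral metric: the sum of the `K` largest entries of `v`,
i.e. the supremum over `K`-element index sets `S` of `∑ i ∈ S, v i`. -/
noncomputable def Kspec {T : ℕ} (K : ℕ) (v : Fin T → ℝ) : ℝ :=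
  sSup {x : ℝ | ∃ S : Finset (Fin T), S.card = K ∧ x = ∑ i ∈ S, v i}

theorem finite_setOf_sum_card_eq {T : ℕ} (K : ℕ) (v : Fin T → ℝ) :
    {x : ℝ | ∃ S : Finset (Fin T), S.card = K ∧ x = ∑ i ∈ S, v i}.Finite := by
  refine (Set.finite_range fun S : Finset (Fin T) => ∑ i ∈ S, v i).subset ?_
  rintro x ⟨S, -, rfl⟩
  exact ⟨S, rfl⟩

theorem sum_le_Kspec {T K : ℕ} (v : Fin T → ℝ) {S : Finset (Fin T)} (hS : S.card = K) :
    ∑ i ∈ S, v i ≤ Kspec K v :=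
  le_csSup (finite_setOf_sum_card_eq K v).bddAbove ⟨S, hS, rfl⟩

theorem exists_Kspec_eq_sum {T K : ℕ} (hKT : K ≤ T) (v : Fin T → ℝ) :
    ∃ S : Finset (Fin T), S.card = K ∧ Kspec K v = ∑ i ∈ S, v i := by
  obtain ⟨S, hS⟩ := Finset.exists_subset_card_eq
    (s := (Finset.univ : Finset (Fin T))) (n := K) (by simpa using hKT)
  have hne : {x : ℝ | ∃ S : Finset (Fin T), S.card = K ∧ x = ∑ i ∈ S, v i}.Nonempty :=
    ⟨_, S, hS.2, rfl⟩
  exact hne.csSup_mem (finite_setOf_sum_card_eq K v)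

/-- Equality case of Cauchy–Schwarz against the indicator of `S`: if the sum of `w` over `S` is at
least the extremal value `#S * α`, then `w` is flat on `S` and vanishes off `S`. -/
theorem flat_of_card_mul_le_sum {ι : Type*} [Fintype ι] [DecidableEq ι] {S : Finset ι} {w : ι → ℝ}
    {α : ℝ} (hα : 0 ≤ α) (hw : ∑ i, w i ^ 2 = S.card * α ^ 2) (h : S.card * α ≤ ∑ i ∈ S, w i) :
    (∀ i ∈ S, w i = α) ∧ ∀ i ∉ S, w i = 0 := by
  have hsplit := Finset.sum_add_sum_compl S fun i => w i ^ 2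
  have hexp : ∑ i ∈ S, (w i - α) ^ 2
      = ∑ i ∈ S, w i ^ 2 - 2 * α * ∑ i ∈ S, w i + S.card * α ^ 2 := by
    simp only [sub_sq, Finset.sum_add_distrib, Finset.sum_sub_distrib, Finset.mul_sum,
      Finset.sum_const, nsmul_eq_mul]
    congr 2
    exact Finset.sum_congr rfl fun i _ => by ring
  have hin : 0 ≤ ∑ i ∈ S, (w i - α) ^ 2 := Finset.sum_nonneg fun i _ => sq_nonneg _
  have hout : 0 ≤ ∑ i ∈ Sᶜ, w i ^ 2 := Finset.sum_nonneg fun i _ => sq_nonneg _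
  have hmul := mul_le_mul_of_nonneg_left h hα
  have hin0 : ∑ i ∈ S, (w i - α) ^ 2 = 0 := by linarith
  have hout0 : ∑ i ∈ Sᶜ, w i ^ 2 = 0 := by linarith
  rw [Finset.sum_eq_zero_iff_of_nonneg fun i _ => sq_nonneg _] at hin0 hout0
  exact ⟨fun i hi => sub_eq_zero.mp (pow_eq_zero_iff two_ne_zero |>.mp (hin0 i hi)),
    fun i hi => pow_eq_zero_iff two_ne_zero |>.mp (hout0 i (Finset.mem_compl.mpr hi))⟩

/-- A vector `v` with exactly `K` nonzero entries all equal to a common value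
`α > 0` with `K·α² = T` strictly dominates, in K-spectral metric, any
nonnegative `w` with `∑ s, w s ^ 2 = T` that is not of this form. -/
theorem kspec_flat_strictly_dominates (T K : ℕ) (hK : 1 ≤ K) (hKT : K ≤ T)
    (v w : Fin T → ℝ) (hv : ∀ i, 0 ≤ v i) (hw : ∀ i, 0 ≤ w i)
    (α : ℝ) (hα : 0 < α) (hαT : (K : ℝ) * α ^ 2 = (T : ℝ))
    (hvform : ∃ S : Finset (Fin T), S.card = K ∧
      (∀ i ∈ S, v i = α) ∧ (∀ i ∉ S, v i = 0))
    (hwsum : ∑ s, w s ^ 2 = (T : ℝ))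
    (hwform : ¬ ∃ (S : Finset (Fin T)) (β : ℝ), S.card = K ∧ 0 < β ∧
      (∀ i ∈ S, w i = β) ∧ (∀ i ∉ S, w i = 0)) :
    Kspec K w < Kspec K v := by
  obtain ⟨A, hA, hAv, -⟩ := hvform
  obtain ⟨S, hS, hSw⟩ := exists_Kspec_eq_sum hKT w
  have hKα : (K : ℝ) * α ≤ Kspec K v := by
    simpa [Finset.sum_congr rfl hAv, hA] using sum_le_Kspec v hA
  refine lt_of_lt_of_le ?_ hKα
  by_contra! hle
  obtain ⟨hin, hout⟩ := flat_of_card_mul_le_sum (S := S) hα.le (by rw [hwsum, hS, hαT])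
    (by rwa [hS, ← hSw])
  exact hwform ⟨S, α, hS, hα, hin, hout⟩
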